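/- Let C ⊆ ℝ² be a convex body with 0 ∈ interior C. Let B ⊆ ℝ² be a nonempty compact set, let z ∈ ℝ², and let b ∈ B be a nearest point of B to z, i.e., gauge C (b − z) = 𝔡_C(z, B). Let x be any point on the segment [z, b], and let R ⊆ ℝ² be a nonempty set with 𝔡_C(x, R) ≤ gauge C (b − x). Then 𝔡_C(z, R) ≤ 𝔡_C(z, B). -/

import Mathlib

open Set

/-- The Euclidean plane. -/
abbrev Plane := EuclideanSpace ℝ (Fin 2)

/-- Convex distance from a point `p` to a set `S`, induced by the convex
body `C` via the Minkowski functional: `𝔡_C(p, S) = inf_{q ∈ S} gauge C (q - p)`. -/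
noncomputable def convDist (C : Set Plane) (p : Plane) (S : Set Plane) : ℝ :=
  ⨅ q : S, gauge C ((q : Plane) - p)

theorem convDist_le_gauge (C : Set Plane) (p : Plane) {S : Set Plane} {q : Plane} (hq : q ∈ S) :
    convDist C p S ≤ gauge C (q - p) :=
  ciInf_le (f := fun q : S => gauge C ((q : Plane) - p))
    ⟨0, by rintro _ ⟨r, rfl⟩; exact gauge_nonneg _⟩ ⟨q, hq⟩

theorem convDist_le_gauge_add_convDist {C : Set Plane} (hC : Convex ℝ C)
    (h0 : (0 : Plane) ∈ interior C) (z x : Plane) {S : Set Plane} (hS : S.Nonempty) :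
    convDist C z S ≤ gauge C (x - z) + convDist C x S := by
  have : Nonempty S := hS.to_subtype
  rw [← sub_le_iff_le_add']
  refine le_ciInf fun q => ?_
  have hadd := gauge_add_le hC (absorbent_nhds_zero (mem_interior_iff_mem_nhds.mp h0))
    (x - z) ((q : Plane) - x)
  rw [sub_add_sub_cancel'] at hadd
  linarith [convDist_le_gauge C z q.2]

theorem gauge_add_gauge_of_mem_segment (C : Set Plane) {z b x : Plane} (hx : x ∈ segment ℝ z b) :
    gauge C (x - z) + gauge C (b - x) = gauge C (b - z) := by
  obtain ⟨s, t, hs, ht, hst, rfl⟩ := hx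
  obtain rfl : s = 1 - t := by linarith
  have h₁ : (1 - t) • z + t • b - z = t • (b - z) := by module
  have h₂ : b - ((1 - t) • z + t • b) = (1 - t) • (b - z) := by module
  rw [h₁, h₂, gauge_smul_of_nonneg ht, gauge_smul_of_nonneg hs, smul_eq_mul, smul_eq_mul]
  ring

theorem closer_site_along_segment_to_nearest_point
    (C : Set Plane) (hCc : IsCompact C) (hCconv : Convex ℝ C)
    (h0 : (0 : Plane) ∈ interior C)
    (B : Set Plane) (hBne : B.Nonempty) (hBc : IsCompact B)
    (z : Plane) (b : Plane) (hb : b ∈ B)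
    (hnear : gauge C (b - z) = convDist C z B)
    (x : Plane) (hx : x ∈ segment ℝ z b)
    (R : Set Plane) (hRne : R.Nonempty)
    (hR : convDist C x R ≤ gauge C (b - x)) :
    convDist C z R ≤ convDist C z B := by
  linarith [convDist_le_gauge_add_convDist hCconv h0 z x hRne, gauge_add_gauge_of_mem_segment C hx]
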